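/- Let m ≥ 2. For a weight value w, let A_w = #{(a,b) ∈ F_{2^m} × F_{2^m} : wt(c(a,b)) = w}, where wt(c(a,b)) = #{(x,y) ∈ D_1 : Tr(axy + bx) = 1}. Then A_0 = 1 (attained only by (a,b) = (0,0)), A_{2^{m−1}(2^{m−1}−1)} = 2^{m−2}(2^{m−1} − 1), A_{2^{2m−2}} = 3·2^{2m−2} − 1, A_{2^{m−1}(2^{m−1}+1)} = 2^{m−2}(2^{m−1} + 1), and A_w = 0 for every other value of w. In particular, the code C_{D_1} has length 2^{2m−1}, exactly 2^{2m} codewords, minimum distance 2^{m−1}(2^{m−1} − 1), and exactly three nonzero weights. -/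

import Mathlib

attribute [local instance] Classical.propDecidable

noncomputable instance (m : ℕ) : Fintype (GaloisField 2 m) := Fintype.ofFinite _

/-- The absolute trace map from `F_{2^m}` to `F_2`. -/
noncomputable def Tr (m : ℕ) (x : GaloisField 2 m) : ZMod 2 :=
  Algebra.trace (ZMod 2) (GaloisField 2 m) x

/-- For `t ∈ F_2`, `sgn t` is the integer `(-1)^t`. -/
def sgn : ZMod 2 → ℤ := fun t => if t = 0 then 1 else -1

/-- The set `Υ₁ = {r + r⁻¹ : r ∈ F_{2^m}^*, r ≠ 1}`. -/
def Ups1 (m : ℕ) : Set (GaloisField 2 m) :=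
  {u | ∃ r : GaloisField 2 m, r ≠ 0 ∧ r ≠ 1 ∧ u = r + r⁻¹}

open Finset

/-- The additive character `x ↦ (-1)^Tr(x)` with integer values. -/
noncomputable def trChar (m : ℕ) (x : GaloisField 2 m) : ℤ := sgn (Tr m x)

/-- The defining set `{(x, y) : x ≠ 0, Tr(y x² + y) = 0}`. -/
noncomputable def defSet (m : ℕ) : Finset (GaloisField 2 m × GaloisField 2 m) :=
  univ.filter (fun p => p.1 ≠ 0 ∧ Tr m (p.2 * p.1 ^ 2 + p.2) = 0)

/-- The Hamming weight of the codeword `c(a, b)`. -/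
noncomputable def codeWt (m : ℕ) (c : GaloisField 2 m × GaloisField 2 m) : ℕ :=
  ((defSet m).filter (fun p => Tr m (c.1 * p.1 * p.2 + c.2 * p.1) = 1)).card

/-- The character sum of the codeword `c(a, b)` over the defining set. -/
noncomputable def codeSum (m : ℕ) (c : GaloisField 2 m × GaloisField 2 m) : ℤ :=
  ∑ p ∈ defSet m, trChar m (c.1 * p.1 * p.2 + c.2 * p.1)

lemma Tr_add (m : ℕ) (x y : GaloisField 2 m) : Tr m (x + y) = Tr m x + Tr m y :=
  map_add _ x y

lemma Tr_zero (m : ℕ) : Tr m 0 = 0 := map_zero _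

lemma sgn_add (s t : ZMod 2) : sgn (s + t) = sgn s * sgn t := by
  revert s t; decide

lemma trChar_add (m : ℕ) (x y : GaloisField 2 m) :
    trChar m (x + y) = trChar m x * trChar m y := by
  simp only [trChar, Tr_add, sgn_add]

lemma trChar_zero (m : ℕ) : trChar m 0 = 1 := by
  simp [trChar, Tr_zero, sgn]

lemma trChar_eq_one_or (m : ℕ) (x : GaloisField 2 m) : trChar m x = 1 ∨ trChar m x = -1 := by
  unfold trChar sgn
  split_ifs <;> simp

lemma card_galoisField (m : ℕ) (hm : m ≠ 0) : Fintype.card (GaloisField 2 m) = 2 ^ m := by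
  rw [← Nat.card_eq_fintype_card, GaloisField.card 2 m hm]

lemma sum_trChar_mul (m : ℕ) (hm : m ≠ 0) (a : GaloisField 2 m) :
    ∑ x, trChar m (a * x) = if a = 0 then 2 ^ m else 0 := by
  split_ifs with h
  · subst h
    simp [trChar_zero, card_galoisField m hm]
  · obtain ⟨w, hw⟩ := Algebra.trace_surjective (ZMod 2) (GaloisField 2 m) 1
    have hz : trChar m (a * (a⁻¹ * w)) = -1 := by
      rw [mul_inv_cancel_left₀ h]
      have : Tr m w = 1 := hw
      simp [trChar, this, sgn]
    have key := Equiv.sum_comp (Equiv.addRight (a⁻¹ * w)) (fun x => trChar m (a * x))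
    simp only [Equiv.coe_addRight, mul_add a, trChar_add, hz, ← Finset.sum_mul] at key
    linarith

lemma two_mul_codeWt (m : ℕ) (c : GaloisField 2 m × GaloisField 2 m) :
    2 * (codeWt m c : ℤ) = (defSet m).card - codeSum m c := by
  have h : ∀ t : ZMod 2, sgn t = 1 - 2 * (if t = 1 then 1 else 0) := by decide
  simp only [codeWt, codeSum, trChar, h, sum_sub_distrib, ← mul_sum, card_filter, sum_const]
  push_cast
  simp

lemma two_mul_codeSum (m : ℕ) (hm : m ≠ 0) (a b : GaloisField 2 m) :
    2 * codeSum m (a, b) = ∑ x, if x ≠ 0 then trChar m (b * x) *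
      ((if a * x = 0 then 2 ^ m else 0) + (if x ^ 2 + a * x + 1 = 0 then 2 ^ m else 0))
      else 0 := by
  have h : ∀ t : ZMod 2, 2 * (if t = 0 then 1 else 0) = 1 + sgn t := by decide
  unfold codeSum defSet
  rw [sum_filter, ← univ_product_univ, sum_product, mul_sum]
  refine sum_congr rfl fun x _ => ?_
  by_cases hx : x = 0
  · simp [hx]
  rw [if_pos hx, ← sum_trChar_mul m hm, ← sum_trChar_mul m hm, ← sum_add_distrib, mul_sum, mul_sum]
  refine sum_congr rfl fun y _ => ?_
  have e1 : (x ^ 2 + a * x + 1) * y = a * x * y + (y * x ^ 2 + y) := by ring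
  rw [e1, trChar_add, trChar_add]
  have := h (Tr m (y * x ^ 2 + y))
  by_cases ht : Tr m (y * x ^ 2 + y) = 0
  · simp only [ht, if_true, hx, ne_eq, not_false_eq_true, and_self, trChar] at this ⊢
    linear_combination (sgn (Tr m (a * x * y)) * sgn (Tr m (b * x))) * this
  · simp only [ht, if_false, and_false, trChar] at this ⊢
    linear_combination (sgn (Tr m (a * x * y)) * sgn (Tr m (b * x))) * this

lemma codeSum_zero_left (m : ℕ) (hm : m ≠ 0) (b : GaloisField 2 m) :
    2 * codeSum m (0, b) = 2 ^ m * ((if b = 0 then 2 ^ m else 0) - 1 + trChar m b) := by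
  have h1 : ∀ x : GaloisField 2 m, x ^ 2 + 0 * x + 1 = 0 ↔ x = 1 := by
    intro x
    have : x ^ 2 + 0 * x + 1 = (x + 1) ^ 2 := by rw [CharTwo.add_sq]; ring
    rw [this, sq_eq_zero_iff, CharTwo.add_eq_zero]
  rw [two_mul_codeSum m hm, ← sum_trChar_mul m hm]
  have h2 : ∀ x : GaloisField 2 m, (if x ≠ 0 then trChar m (b * x) *
      ((if 0 * x = 0 then (2 : ℤ) ^ m else 0) + (if x ^ 2 + 0 * x + 1 = 0 then 2 ^ m else 0))
      else 0) = 2 ^ m * trChar m (b * x) - (if x = 0 then 2 ^ m else 0)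
        + (if x = 1 then 2 ^ m * trChar m b else 0) := by
    intro x
    rw [h1]
    by_cases hx : x = 0
    · simp [hx, trChar_zero]
    · by_cases hx1 : x = 1
      · simp [hx1]; ring
      · simp [hx, hx1]; ring
  simp only [h2, sum_add_distrib, sum_sub_distrib, ← mul_sum, sum_ite_eq', mem_univ, if_true]
  ring

lemma codeSum_zero (m : ℕ) (hm : m ≠ 0) : 2 * codeSum m (0, 0) = 2 ^ m * 2 ^ m := by
  simp [codeSum_zero_left m hm, trChar_zero]

lemma card_defSet (m : ℕ) : ((defSet m).card : ℤ) = codeSum m (0, 0) := by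
  simp [codeSum, trChar_zero]

lemma codeSum_of_ne_zero_left (m : ℕ) (hm : m ≠ 0) (a b : GaloisField 2 m) (ha : a ≠ 0) :
    2 * codeSum m (a, b) =
      2 ^ m * ∑ x ∈ univ.filter (fun x => x ^ 2 + a * x + 1 = 0), trChar m (b * x) := by
  rw [two_mul_codeSum m hm, sum_filter, mul_sum]
  refine sum_congr rfl fun x _ => ?_
  by_cases hx : x = 0
  · simp [hx]
  · simp [hx, ha, mul_comm]

lemma codeSum_mem (m : ℕ) (hm : m ≠ 0) (c : GaloisField 2 m × GaloisField 2 m)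
    (hc : c ≠ (0, 0)) : codeSum m c = 2 ^ m ∨ codeSum m c = 0 ∨ codeSum m c = -2 ^ m := by
  obtain ⟨a, b⟩ := c
  by_cases ha : a = 0
  · subst ha
    have hb : b ≠ 0 := fun h => hc (by rw [h])
    have := codeSum_zero_left m hm b
    rw [if_neg hb] at this
    rcases trChar_eq_one_or m b with h | h <;> rw [h] at this
    · right; left; linarith
    · right; right; linarith
  have key := codeSum_of_ne_zero_left m hm a b ha
  by_cases hr : ∃ r : GaloisField 2 m, r ^ 2 + a * r + 1 = 0
  · obtain ⟨r, hr⟩ := hr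
    have hset : univ.filter (fun x : GaloisField 2 m => x ^ 2 + a * x + 1 = 0) = {r, r + a} := by
      ext x
      simp only [mem_filter, mem_univ, true_and, mem_insert, mem_singleton]
      have hf : x ^ 2 + a * x + 1 = (x + r) * (x + (r + a)) := by
        have h2 : (2 : GaloisField 2 m) = 0 := CharTwo.two_eq_zero
        linear_combination hr - (r ^ 2 + r * x + a * r) * h2
      rw [hf, mul_eq_zero, CharTwo.add_eq_zero, CharTwo.add_eq_zero]
    rw [hset, sum_pair (by simpa using ha)] at key
    rcases trChar_eq_one_or m (b * r) with h | h <;>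
      rcases trChar_eq_one_or m (b * (r + a)) with h' | h' <;> rw [h, h'] at key
    · left; linarith
    · right; left; linarith
    · right; left; linarith
    · right; right; linarith
  · push Not at hr
    rw [filter_false_of_mem fun x _ => hr x] at key
    right; left
    simpa using key

lemma sum_trChar_mul_add_mul (m : ℕ) (hm : m ≠ 0) (u v : GaloisField 2 m) :
    ∑ c : GaloisField 2 m × GaloisField 2 m, trChar m (c.1 * u + c.2 * v) =
      if u = 0 ∧ v = 0 then 2 ^ m * 2 ^ m else 0 := by
  have h : ∑ c : GaloisField 2 m × GaloisField 2 m, trChar m (c.1 * u + c.2 * v) =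
      (∑ x, trChar m (u * x)) * ∑ x, trChar m (v * x) := by
    rw [← univ_product_univ, sum_product, sum_mul_sum]
    simp only [trChar_add, mul_comm]
  rw [h, sum_trChar_mul m hm, sum_trChar_mul m hm]
  by_cases hu : u = 0 <;> by_cases hv : v = 0 <;> simp [hu, hv]

lemma sum_codeSum (m : ℕ) (hm : m ≠ 0) : ∑ c, codeSum m c = 0 := by
  unfold codeSum
  rw [sum_comm]
  refine sum_eq_zero fun p hp => ?_
  have hp0 : p.1 ≠ 0 := (mem_filter.1 hp).2.1
  simp only [mul_assoc]
  rw [sum_trChar_mul_add_mul m hm, if_neg (by simp [hp0])]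

lemma sum_codeSum_sq (m : ℕ) (hm : m ≠ 0) :
    ∑ c, codeSum m c ^ 2 = 2 ^ m * 2 ^ m * (defSet m).card := by
  simp only [codeSum, sq, sum_mul_sum]
  rw [sum_comm]
  have h : ∀ p ∈ defSet m, ∑ c : GaloisField 2 m × GaloisField 2 m, ∑ p' ∈ defSet m,
      trChar m (c.1 * p.1 * p.2 + c.2 * p.1) * trChar m (c.1 * p'.1 * p'.2 + c.2 * p'.1) =
        2 ^ m * 2 ^ m := by
    intro p hp
    have hp0 : p.1 ≠ 0 := (mem_filter.1 hp).2.1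
    rw [sum_comm, sum_eq_single_of_mem p hp]
    · simp [← trChar_add, CharTwo.add_self_eq_zero, trChar_zero, card_galoisField m hm]
    · intro p' _ hne
      have e : ∀ c : GaloisField 2 m × GaloisField 2 m,
          c.1 * p.1 * p.2 + c.2 * p.1 + (c.1 * p'.1 * p'.2 + c.2 * p'.1) =
            c.1 * (p.1 * p.2 + p'.1 * p'.2) + c.2 * (p.1 + p'.1) := fun c => by ring
      simp only [← trChar_add, e]
      rw [sum_trChar_mul_add_mul m hm, if_neg]
      rintro ⟨h1, h2⟩
      rw [CharTwo.add_eq_zero] at h1 h2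
      rw [← h2] at h1
      exact hne (Prod.ext h2.symm (mul_left_cancel₀ hp0 h1).symm)
  rw [sum_congr rfl h, sum_const, nsmul_eq_mul, mul_comm]

lemma codeWt_add_eq_zero (m : ℕ) (c c' : GaloisField 2 m × GaloisField 2 m)
    (h : ∀ p ∈ defSet m, Tr m (c.1 * p.1 * p.2 + c.2 * p.1) =
      Tr m (c'.1 * p.1 * p.2 + c'.2 * p.1)) : codeWt m (c + c') = 0 := by
  rw [codeWt, card_eq_zero, filter_eq_empty_iff]
  intro p hp
  have e : (c + c').1 * p.1 * p.2 + (c + c').2 * p.1 =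
      (c.1 * p.1 * p.2 + c.2 * p.1) + (c'.1 * p.1 * p.2 + c'.2 * p.1) := by
    simp only [Prod.fst_add, Prod.snd_add]; ring
  rw [e, Tr_add, h p hp, CharTwo.add_self_eq_zero]
  decide

/-- The number of codewords with a given character sum. -/
noncomputable def codeSumCount (m : ℕ) (s : ℤ) : ℕ :=
  (univ.filter (fun c : GaloisField 2 m × GaloisField 2 m => codeSum m c = s)).card

/-- A sum over all codewords of a function of the character sum splits over its four values. -/
lemma sum_comp_codeSum (m : ℕ) (hm : 2 ≤ m) (f : ℤ → ℤ) :
    ∑ c, f (codeSum m c) = f (codeSum m (0, 0)) + codeSumCount m (2 ^ m) * f (2 ^ m) +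
      codeSumCount m 0 * f 0 + codeSumCount m (-2 ^ m) * f (-2 ^ m) := by
  have hm0 : m ≠ 0 := by omega
  have h4 : (4 : ℤ) ≤ 2 ^ m := by
    calc (4 : ℤ) = 2 ^ 2 := by norm_num
      _ ≤ 2 ^ m := pow_le_pow_right₀ (by norm_num) hm
  have h0 := codeSum_zero m hm0
  have hlt : (2 : ℤ) ^ m < codeSum m (0, 0) := by nlinarith
  have key : ∀ c, f (codeSum m c) = (if c = (0, 0) then f (codeSum m (0, 0)) else 0) +
      (if codeSum m c = 2 ^ m then 1 else 0) * f (2 ^ m) +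
      (if codeSum m c = 0 then 1 else 0) * f 0 +
      (if codeSum m c = -2 ^ m then 1 else 0) * f (-2 ^ m) := by
    intro c
    by_cases hc : c = (0, 0)
    · subst hc
      rw [if_pos rfl, if_neg (by omega), if_neg (by omega), if_neg (by omega)]
      ring
    · rw [if_neg hc]
      rcases codeSum_mem m hm0 c hc with h | h | h <;> rw [h]
      · rw [if_pos rfl, if_neg (by omega), if_neg (by omega)]; ring
      · rw [if_neg (by omega), if_pos rfl, if_neg (by omega)]; ring
      · rw [if_neg (by omega), if_neg (by omega), if_pos rfl]; ring
  rw [sum_congr rfl fun c _ => key c]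
  simp only [sum_add_distrib, ← sum_mul, sum_ite_eq', mem_univ, if_true, codeSumCount,
    card_filter]
  push_cast
  rfl

lemma codeSumCount_eq (m : ℕ) (hm : 2 ≤ m) (k : ℤ) (hk : (2 : ℤ) ^ m = 4 * k) (hk0 : 0 < k) :
    (codeSumCount m (2 ^ m) : ℤ) = k * (2 * k - 1) ∧
    (codeSumCount m 0 : ℤ) = 12 * k ^ 2 - 1 ∧
    (codeSumCount m (-2 ^ m) : ℤ) = k * (2 * k + 1) := by
  have hm0 : m ≠ 0 := by omega
  have h0 : codeSum m (0, 0) = 8 * k ^ 2 := by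
    have := codeSum_zero m hm0
    rw [hk] at this
    linarith
  have s0 := sum_comp_codeSum m hm (fun _ => 1)
  have s1 := sum_comp_codeSum m hm (fun x => x)
  have s2 := sum_comp_codeSum m hm (fun x => x ^ 2)
  rw [sum_codeSum m hm0] at s1
  rw [sum_codeSum_sq m hm0, card_defSet] at s2
  simp only [sum_const, card_univ, Fintype.card_prod, card_galoisField m hm0, nsmul_eq_mul] at s0
  push_cast at s0
  rw [h0] at s1 s2
  rw [hk] at s0 s1 s2 ⊢
  have t1 : (codeSumCount m (-(4 * k)) : ℤ) - codeSumCount m (4 * k) = 2 * k := by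
    apply mul_left_cancel₀ (mul_ne_zero four_ne_zero hk0.ne')
    linear_combination s1
  have t2 : (codeSumCount m (-(4 * k)) : ℤ) + codeSumCount m (4 * k) = 4 * k ^ 2 := by
    apply mul_left_cancel₀ (pow_ne_zero 2 (mul_ne_zero (four_ne_zero (α := ℤ)) hk0.ne'))
    linear_combination -s2
  exact ⟨by linarith, by linarith, by linarith⟩

theorem stmt11 (m : ℕ) (hm : 2 ≤ m) :
    let D1 : Finset (GaloisField 2 m × GaloisField 2 m) :=
      Finset.univ.filter (fun p => p.1 ≠ 0 ∧ Tr m (p.2 * p.1 ^ 2 + p.2) = 0)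
    let wt : GaloisField 2 m × GaloisField 2 m → ℕ := fun c =>
      (D1.filter (fun p => Tr m (c.1 * p.1 * p.2 + c.2 * p.1) = 1)).card
    let A : ℕ → ℕ := fun w =>
      (Finset.univ.filter (fun c : GaloisField 2 m × GaloisField 2 m => wt c = w)).card
    A 0 = 1 ∧
    (∀ c : GaloisField 2 m × GaloisField 2 m, wt c = 0 → c = (0, 0)) ∧
    A (2 ^ (m - 1) * (2 ^ (m - 1) - 1)) = 2 ^ (m - 2) * (2 ^ (m - 1) - 1) ∧
    A (2 ^ (2 * m - 2)) = 3 * 2 ^ (2 * m - 2) - 1 ∧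
    A (2 ^ (m - 1) * (2 ^ (m - 1) + 1)) = 2 ^ (m - 2) * (2 ^ (m - 1) + 1) ∧
    (∀ w : ℕ, w ≠ 0 → w ≠ 2 ^ (m - 1) * (2 ^ (m - 1) - 1) → w ≠ 2 ^ (2 * m - 2) →
      w ≠ 2 ^ (m - 1) * (2 ^ (m - 1) + 1) → A w = 0) ∧
    D1.card = 2 ^ (2 * m - 1) ∧
    (Finset.univ.image (fun c : GaloisField 2 m × GaloisField 2 m =>
        fun p : GaloisField 2 m × GaloisField 2 m =>
          if p ∈ D1 then Tr m (c.1 * p.1 * p.2 + c.2 * p.1) else 0)).card = 2 ^ (2 * m) ∧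
    (∀ c : GaloisField 2 m × GaloisField 2 m, c ≠ (0, 0) →
      2 ^ (m - 1) * (2 ^ (m - 1) - 1) ≤ wt c) ∧
    (∃ c : GaloisField 2 m × GaloisField 2 m, wt c = 2 ^ (m - 1) * (2 ^ (m - 1) - 1)) ∧
    ((Finset.univ.image (fun c : GaloisField 2 m × GaloisField 2 m => wt c)).erase 0).card
      = 3 := by
  intro D1 wt A
  have hm0 : m ≠ 0 := by omega
  obtain ⟨k, hk⟩ : ∃ k : ℕ, 2 ^ (m - 2) = k := ⟨_, rfl⟩
  have hk0 : 0 < k := hk ▸ by positivity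
  have p1 : 2 ^ (m - 1) = 2 * k := by
    rw [← hk, ← pow_succ']; congr 1; omega
  have p2 : 2 ^ m = 4 * k := by
    rw [← hk, show 4 = 2 ^ 2 from rfl, ← pow_add]; congr 1; omega
  have p3 : 2 ^ (2 * m - 2) = 4 * k ^ 2 := by
    rw [show 2 * m - 2 = (m - 1) + (m - 1) by omega, pow_add, p1]; ring
  have p4 : 2 ^ (2 * m - 1) = 8 * k ^ 2 := by
    rw [show 2 * m - 1 = (m - 1) + m by omega, pow_add, p1, p2]; ring
  have p5 : 2 ^ (2 * m) = 16 * k ^ 2 := by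
    rw [two_mul, pow_add, p2]; ring
  have p2' : (2 : ℤ) ^ m = 4 * k := by exact_mod_cast p2
  rw [p1, p3, p4, p5, hk]
  obtain ⟨j, rfl⟩ : ∃ j, k = j + 1 := ⟨k - 1, by omega⟩
  have q1 : 2 * (j + 1) - 1 = 2 * j + 1 := by omega
  rw [q1]
  have hwt : ∀ c, wt c = codeWt m c := fun _ => rfl
  have h0 : codeSum m (0, 0) = 8 * ((j : ℤ) + 1) ^ 2 := by
    have := codeSum_zero m hm0
    rw [p2'] at this
    push_cast at this
    linarith
  have hS : ∀ c, codeSum m c = 8 * ((j : ℤ) + 1) ^ 2 - 2 * (wt c : ℤ) := by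
    intro c
    have := two_mul_codeWt m c
    rw [card_defSet, h0] at this
    rw [hwt]
    linarith
  have hcases : ∀ c, c ≠ (0, 0) → wt c = 2 * (j + 1) * (2 * j + 1) ∨ wt c = 4 * (j + 1) ^ 2 ∨
      wt c = 2 * (j + 1) * (2 * (j + 1) + 1) := by
    intro c hc
    have h := codeSum_mem m hm0 c hc
    rw [hS, p2'] at h
    push_cast at h
    rcases h with h | h | h
    · left; zify; linarith
    · right; left; zify; linarith
    · right; right; zify; linarith
  have hpos : ∀ c, c ≠ (0, 0) → 2 * (j + 1) * (2 * j + 1) ≤ wt c := by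
    intro c hc
    rcases hcases c hc with h | h | h <;> rw [h] <;> nlinarith
  have hz : wt (0, 0) = 0 := by
    have := hS (0, 0)
    rw [h0] at this
    omega
  have hzero : ∀ c, wt c = 0 → c = (0, 0) := by
    intro c h
    by_contra hc
    have := hpos c hc
    rw [h] at this
    exact absurd this (Nat.not_le.2 (by positivity))
  have hA : ∀ (w : ℕ) (s : ℤ), s = 8 * ((j : ℤ) + 1) ^ 2 - 2 * (w : ℤ) →
      A w = codeSumCount m s := by
    intro w s hs
    refine congrArg card (filter_congr fun c _ => ?_)
    rw [hS, hs]
    omega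
  obtain ⟨n1, n2, n3⟩ := codeSumCount_eq m hm (j + 1) (by rw [p2']; push_cast; ring) (by positivity)
  have a1 : A (2 * (j + 1) * (2 * j + 1)) = (j + 1) * (2 * j + 1) := by
    rw [hA _ (2 ^ m) (by rw [p2']; push_cast; ring)]
    zify
    rw [n1]; ring
  have a2 : A (4 * (j + 1) ^ 2) = 3 * (4 * (j + 1) ^ 2) - 1 := by
    rw [hA _ 0 (by push_cast; ring)]
    zify [show 1 ≤ 3 * (4 * (j + 1) ^ 2) by nlinarith]
    rw [n2]; ring
  have a3 : A (2 * (j + 1) * (2 * (j + 1) + 1)) = (j + 1) * (2 * (j + 1) + 1) := by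
    rw [hA _ (-2 ^ m) (by rw [p2']; push_cast; ring)]
    zify
    rw [n3]
  have hex : ∀ w, 0 < A w → ∃ c, wt c = w := by
    intro w hw
    obtain ⟨c, hc⟩ := card_pos.1 hw
    exact ⟨c, (mem_filter.1 hc).2⟩
  have e1 := hex (2 * (j + 1) * (2 * j + 1)) (by rw [a1]; positivity)
  have e2 := hex (4 * (j + 1) ^ 2) (by
    have : 0 < (j + 1) ^ 2 := by positivity
    rw [a2]
    omega)
  have e3 := hex (2 * (j + 1) * (2 * (j + 1) + 1)) (by rw [a3]; positivity)
  refine ⟨?_, hzero, a1, a2, a3, ?_, ?_, ?_, hpos, e1, ?_⟩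
  · refine card_eq_one.2 ⟨(0, 0), ?_⟩
    ext c
    simp only [mem_filter, mem_univ, true_and, mem_singleton]
    exact ⟨hzero c, fun h => h ▸ hz⟩
  · intro w w0 w1 w2 w3
    refine card_eq_zero.2 (filter_eq_empty_iff.2 fun c _ hc => ?_)
    subst hc
    rcases hcases c (fun h => w0 (h ▸ hz)) with h | h | h
    · exact w1 h
    · exact w2 h
    · exact w3 h
  · have := card_defSet m
    rw [h0] at this
    exact_mod_cast this
  · rw [card_image_of_injective, card_univ, Fintype.card_prod, card_galoisField m hm0, p2]
    · ring
    · intro c c' h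
      have hadd : c + c' = (0, 0) := by
        refine hzero _ (codeWt_add_eq_zero m c c' fun p hp => ?_)
        have := congrFun h p
        have hp' : p ∈ D1 := hp
        simpa only [if_pos hp'] using this
      have h1 := congrArg Prod.fst hadd
      have h2 := congrArg Prod.snd hadd
      exact Prod.ext (CharTwo.add_eq_zero.1 h1) (CharTwo.add_eq_zero.1 h2)
  · have himage : (univ.image (fun c => wt c)).erase 0 = {2 * (j + 1) * (2 * j + 1),
        4 * (j + 1) ^ 2, 2 * (j + 1) * (2 * (j + 1) + 1)} := by
      ext w
      simp only [mem_erase, mem_image, mem_univ, true_and, mem_insert, mem_singleton]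
      constructor
      · rintro ⟨w0, c, rfl⟩
        exact hcases c fun h => w0 (h ▸ hz)
      · rintro (rfl | rfl | rfl)
        · exact ⟨by positivity, e1⟩
        · exact ⟨by positivity, e2⟩
        · exact ⟨by positivity, e3⟩
    rw [himage]
    refine card_eq_three.2 ⟨_, _, _, ?_, ?_, ?_, rfl⟩ <;> intro h <;> nlinarith
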